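/- Let G = (V,E) be a graph of maximum degree K, R ⊂ V a finite set, ℓ ≥ 0 an integer, and B > 0. Suppose real-valued differentiable functions C_v : [0,∞) → [0,∞) satisfy C_v'(t) ≤ K^{2ℓ+1} B · C_v(t) + B · ∑_{u : 0 < dist(u,v) ≤ 2ℓ+1} C_u(t), with C_v(0) = 0 for v ∉ R. Then for any vertex x with dist(x,R) = r and any t with 4(2ℓ+1)K^{2ℓ+1}B t < r, one has C_x(t) ≤ (4(2ℓ+1)K^{2ℓ+1}B t / r)^{r/(2ℓ+1)} · ∑_{y ∈ R} C_y(0). -/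

import Mathlib

open Finset in
/-- A vertex at positive distance has a neighbour one step closer. -/
theorem exists_parent {V : Type*} (G : SimpleGraph V) {w v : V} {n : ℕ}
    (h : G.dist w v = n + 1) : ∃ p, G.Adj w p ∧ G.dist p v = n := by
  obtain ⟨q, hq⟩ := G.exists_walk_of_dist_ne_zero (u := w) (v := v) (by omega)
  cases q with
  | nil => rw [SimpleGraph.dist_self] at h; omega
  | @cons _ p _ ha q' =>
    refine ⟨p, ha, ?_⟩
    have h1 := SimpleGraph.dist_le q'
    have h2 := ha.reachable.dist_triangle_left v
    rw [SimpleGraph.dist_eq_one_iff_adj.2 ha] at h2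
    rw [SimpleGraph.Walk.length_cons] at hq
    omega

open Finset in
/-- The punctured ball of radius `m+1` has at most `K^(m+1)` elements. -/
theorem punctured_ball_card {V : Type*} [Fintype V] [DecidableEq V]
    (G : SimpleGraph V) [DecidableRel G.Adj]
    (K : ℕ) (hK : ∀ v, G.degree v ≤ K) (v : V) (m : ℕ) :
    (univ.filter (fun u => 0 < G.dist u v ∧ G.dist u v ≤ m + 1)).card ≤ K ^ (m + 1) := by
  induction m with
  | zero =>
    have : (univ.filter (fun u => 0 < G.dist u v ∧ G.dist u v ≤ 0 + 1)) ⊆ G.neighborFinset v := by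
      intro u hu
      simp only [mem_filter, mem_univ, true_and] at hu
      rw [SimpleGraph.mem_neighborFinset]
      exact (SimpleGraph.dist_eq_one_iff_adj.1 (by omega : G.dist u v = 1)).symm
    calc _ ≤ _ := card_le_card this
      _ ≤ K := hK v
      _ = _ := by simp
  | succ m ih =>
    have hsub : (univ.filter (fun u => 0 < G.dist u v ∧ G.dist u v ≤ m + 1 + 1)) ⊆
        (univ.filter (fun u => 0 < G.dist u v ∧ G.dist u v ≤ m + 1)).biUnion
          (fun u => insert u ((G.neighborFinset u).filter
            (fun w => G.dist w v = G.dist u v + 1))) := by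
      intro w hw
      simp only [mem_filter, mem_univ, true_and] at hw
      rw [mem_biUnion]
      by_cases h : G.dist w v ≤ m + 1
      · exact ⟨w, by simp only [mem_filter, mem_univ, true_and]; exact ⟨hw.1, h⟩, by simp⟩
      · obtain ⟨p, hp, hpd⟩ := exists_parent G (by omega : G.dist w v = (m + 1) + 1)
        refine ⟨p, by simp only [mem_filter, mem_univ, true_and]; omega, ?_⟩
        rw [mem_insert, mem_filter, SimpleGraph.mem_neighborFinset]
        exact Or.inr ⟨hp.symm, by omega⟩
    calc _ ≤ _ := card_le_card hsub
      _ ≤ (univ.filter (fun u => 0 < G.dist u v ∧ G.dist u v ≤ m + 1)).card * K := by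
        apply card_biUnion_le_card_mul
        intro u hu
        simp only [mem_filter, mem_univ, true_and] at hu
        obtain ⟨p, hp, hpd⟩ := exists_parent G (by omega : G.dist u v = (G.dist u v - 1) + 1)
        have h1 : ((G.neighborFinset u).filter (fun w => G.dist w v = G.dist u v + 1)) ⊆
            (G.neighborFinset u).erase p := by
          intro w hw
          rw [mem_filter] at hw
          rw [mem_erase]
          refine ⟨?_, hw.1⟩
          rintro rfl
          omega
        have h2 := card_le_card h1
        have hpm : p ∈ G.neighborFinset u := by rwa [SimpleGraph.mem_neighborFinset]
        have h3 := card_erase_add_one hpm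
        have h4 := card_insert_le u ((G.neighborFinset u).filter
          (fun w => G.dist w v = G.dist u v + 1))
        have h5 : (G.neighborFinset u).card ≤ K := hK u
        omega
      _ ≤ K ^ (m + 1) * K := Nat.mul_le_mul_right _ ih
      _ = _ := (pow_succ _ _).symm

open Finset in
theorem weighted_bound {V : Type*} [Fintype V] [DecidableEq V]
    (G : SimpleGraph V) [DecidableRel G.Adj]
    (K : ℕ) (hK : ∀ v, G.degree v ≤ K)
    (ℓ : ℕ) (B : ℝ) (hB : 0 < B)
    (C : V → ℝ → ℝ)
    (hdiff : ∀ v, Differentiable ℝ (C v))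
    (hpos : ∀ v t, 0 ≤ t → 0 ≤ C v t)
    (hderiv : ∀ v t, 0 ≤ t →
      deriv (C v) t ≤ (K : ℝ) ^ (2 * ℓ + 1) * B * C v t
        + B * ∑ u ∈ Finset.univ.filter
            (fun u => 0 < G.dist u v ∧ G.dist u v ≤ 2 * ℓ + 1), C u t)
    (w : V → ℝ) (hw : ∀ v, 0 ≤ w v) (M : ℝ) (hM : 0 ≤ M)
    (hwM : ∀ u v, 0 < G.dist u v → G.dist u v ≤ 2 * ℓ + 1 → w v ≤ M * w u)
    (t : ℝ) (ht : 0 ≤ t) :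
    ∑ v, w v * C v t ≤
      Real.exp ((K : ℝ) ^ (2 * ℓ + 1) * B * (1 + M) * t) * ∑ v, w v * C v 0 := by
  set a : ℝ := (K : ℝ) ^ (2 * ℓ + 1) * B with ha
  set F : ℝ → ℝ := fun s => ∑ v, w v * C v s with hF
  have hFd : ∀ s, HasDerivAt F (∑ v, w v * deriv (C v) s) s := by
    intro s
    apply HasDerivAt.fun_sum
    intro v _
    exact ((hdiff v s).hasDerivAt).const_mul (w v)
  have hFle : ∀ s, 0 ≤ s → ∑ v, w v * deriv (C v) s ≤ a * (1 + M) * F s := by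
    intro s hs
    have hcross : ∑ v, w v * ∑ u ∈ univ.filter
        (fun u => 0 < G.dist u v ∧ G.dist u v ≤ 2 * ℓ + 1), C u s
        ≤ (K : ℝ) ^ (2 * ℓ + 1) * M * F s := by
      have e1 : ∑ v, w v * ∑ u ∈ univ.filter
          (fun u => 0 < G.dist u v ∧ G.dist u v ≤ 2 * ℓ + 1), C u s
          = ∑ u, ∑ v ∈ univ.filter
          (fun v => 0 < G.dist v u ∧ G.dist v u ≤ 2 * ℓ + 1), w v * C u s := by
        simp_rw [mul_sum, sum_filter]
        rw [sum_comm]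
        refine sum_congr rfl fun u _ => sum_congr rfl fun v _ => ?_
        rw [G.dist_comm (u := u) (v := v)]
      rw [e1, hF, mul_sum]
      refine sum_le_sum fun u _ => ?_
      calc _ ≤ ∑ v ∈ univ.filter
                (fun v => 0 < G.dist v u ∧ G.dist v u ≤ 2 * ℓ + 1), M * w u * C u s := by
            refine sum_le_sum fun v hv => ?_
            simp only [mem_filter, mem_univ, true_and] at hv
            rw [G.dist_comm] at hv
            exact mul_le_mul_of_nonneg_right (hwM u v hv.1 hv.2) (hpos u s hs)
        _ = ((univ.filter (fun v => 0 < G.dist v u ∧ G.dist v u ≤ 2 * ℓ + 1)).card : ℝ)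
              * (M * w u * C u s) := by rw [sum_const, nsmul_eq_mul]
        _ ≤ (K : ℝ) ^ (2 * ℓ + 1) * (M * w u * C u s) := by
            apply mul_le_mul_of_nonneg_right
            · exact_mod_cast punctured_ball_card G K hK u (2 * ℓ)
            · exact mul_nonneg (mul_nonneg hM (hw u)) (hpos u s hs)
        _ = _ := by ring
    calc ∑ v, w v * deriv (C v) s ≤ ∑ v, w v * (a * C v s + B * ∑ u ∈ univ.filter
            (fun u => 0 < G.dist u v ∧ G.dist u v ≤ 2 * ℓ + 1), C u s) :=
          sum_le_sum fun v _ => mul_le_mul_of_nonneg_left (hderiv v s hs) (hw v)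
      _ = a * F s + B * ∑ v, w v * ∑ u ∈ univ.filter
            (fun u => 0 < G.dist u v ∧ G.dist u v ≤ 2 * ℓ + 1), C u s := by
          rw [hF, mul_sum, mul_sum, ← sum_add_distrib]
          exact sum_congr rfl fun v _ => by ring
      _ ≤ a * F s + B * ((K : ℝ) ^ (2 * ℓ + 1) * M * F s) := by gcongr
      _ = _ := by rw [ha]; ring
  set c := a * (1 + M) with hc
  have hH : ∀ s, HasDerivAt (fun s => Real.exp (-(c * s)) * F s)
      (Real.exp (-(c * s)) * (-(c * 1)) * F s
        + Real.exp (-(c * s)) * ∑ v, w v * deriv (C v) s) s := by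
    intro s
    exact ((((hasDerivAt_id s).const_mul c).neg).exp).mul (hFd s)
  have hanti : AntitoneOn (fun s => Real.exp (-(c * s)) * F s) (Set.Ici 0) := by
    apply antitoneOn_of_deriv_nonpos (convex_Ici 0)
    · exact fun s _ => (hH s).continuousAt.continuousWithinAt
    · exact fun s _ => (hH s).differentiableAt.differentiableWithinAt
    · intro s hs
      rw [interior_Ici] at hs
      rw [(hH s).deriv]
      have h1 := hFle s (le_of_lt hs)
      have h2 := mul_le_mul_of_nonneg_left h1 (Real.exp_pos (-(c * s))).le
      linarith
  have h := hanti (Set.mem_Ici.2 le_rfl) (Set.mem_Ici.2 ht) ht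
  simp only [mul_zero, neg_zero, Real.exp_zero, one_mul] at h
  calc F t = Real.exp (c * t) * (Real.exp (-(c * t)) * F t) := by
        rw [← mul_assoc, ← Real.exp_add]; simp
    _ ≤ _ := mul_le_mul_of_nonneg_left h (Real.exp_pos _).le


/-- Quantum-walk light cone lemma.  Graph of maximum degree K, finite set R,
nonnegative differentiable functions C_v satisfying the differential inequality
C_v' ≤ K^{2ℓ+1}B C_v + B ∑_{0 < dist(u,v) ≤ 2ℓ+1} C_u and vanishing initially
outside R.  Then for dist(x,R)=r and 4(2ℓ+1)K^{2ℓ+1}Bt < r,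
C_x(t) ≤ (4(2ℓ+1)K^{2ℓ+1}Bt/r)^{r/(2ℓ+1)} ∑_{y∈R} C_y(0). -/
theorem stmt_10 {V : Type*} [Fintype V] [DecidableEq V]
    (G : SimpleGraph V) [DecidableRel G.Adj]
    (K : ℕ) (hK : ∀ v, G.degree v ≤ K)
    (ℓ : ℕ) (B : ℝ) (hB : 0 < B)
    (R : Finset V) (hR : R.Nonempty)
    (C : V → ℝ → ℝ)
    (hdiff : ∀ v, Differentiable ℝ (C v))
    (hpos : ∀ v t, 0 ≤ t → 0 ≤ C v t)
    (hderiv : ∀ v t, 0 ≤ t →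
      deriv (C v) t ≤ (K : ℝ) ^ (2 * ℓ + 1) * B * C v t
        + B * ∑ u ∈ Finset.univ.filter
            (fun u => 0 < G.dist u v ∧ G.dist u v ≤ 2 * ℓ + 1), C u t)
    (hinit : ∀ v, v ∉ R → C v 0 = 0)
    (x : V) (r : ℕ)
    (hdist : (R.image (G.dist x)).min' (hR.image _) = r)
    (t : ℝ) (ht : 0 ≤ t)
    (hlc : 4 * (2 * (ℓ : ℝ) + 1) * (K : ℝ) ^ (2 * ℓ + 1) * B * t < r) :
    C x t ≤ (4 * (2 * (ℓ : ℝ) + 1) * (K : ℝ) ^ (2 * ℓ + 1) * B * t / r)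
        ^ ((r : ℝ) / (2 * ℓ + 1)) * ∑ y ∈ R, C y 0 := by
  have ha0 : 0 ≤ (K : ℝ) ^ (2 * ℓ + 1) * B * t := by positivity
  have hm0 : (0 : ℝ) < 2 * (ℓ : ℝ) + 1 := by positivity
  have hr0 : (0 : ℝ) < r := by
    refine lt_of_le_of_lt ?_ hlc
    positivity
  have hrx : ∀ y ∈ R, r ≤ G.dist x y := by
    intro y hy
    have := Finset.min'_le (R.image (G.dist x)) (G.dist x y) (Finset.mem_image_of_mem _ hy)
    rw [hdist] at this
    exact_mod_cast this
  have hrpos : 0 < r := by exact_mod_cast hr0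
  have hxR : x ∉ R := by
    intro hx
    have := hrx x hx
    rw [SimpleGraph.dist_self] at this
    omega
  have hS : 0 ≤ ∑ y ∈ R, C y 0 := Finset.sum_nonneg fun y _ => hpos y 0 le_rfl
  rcases ht.eq_or_lt with h0 | htpos
  · subst h0
    rw [hinit x hxR]
    exact mul_nonneg (Real.rpow_nonneg (by simp) _) hS
  have hKpos : 0 < K := by
    obtain ⟨y, hy⟩ := hR
    have h1 := hrx y hy
    obtain ⟨p, hp, -⟩ := exists_parent G (by omega : G.dist x y = (G.dist x y - 1) + 1)
    have h2 : 0 < G.degree x := (G.degree_pos_iff_exists_adj x).2 ⟨p, hp⟩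
    exact lt_of_lt_of_le h2 (hK x)
  have hapos : 0 < (K : ℝ) ^ (2 * ℓ + 1) * B * t := by positivity
  set A : ℝ := (K : ℝ) ^ (2 * ℓ + 1) * B * t with hA
  set m : ℝ := 2 * (ℓ : ℝ) + 1 with hm
  have hlc' : 4 * (m * A) < r := by rw [hA]; linarith
  set X : ℝ := r / (m * A) with hX
  have hmA : 0 < m * A := by positivity
  have hX4 : 4 < X := by rw [hX, lt_div_iff₀ hmA]; exact hlc'
  have hXpos : 0 < X := by linarith
  set lam : ℝ := X ^ (1 / m) with hlam
  have hlam1 : 1 ≤ lam := Real.one_le_rpow (by linarith) (by positivity)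
  have hlamm : lam ^ (2 * ℓ + 1) = X := by
    rw [hlam, ← Real.rpow_natCast, ← Real.rpow_mul hXpos.le]
    have : 1 / m * ((2 * ℓ + 1 : ℕ) : ℝ) = 1 := by
      rw [hm]; push_cast; field_simp
    rw [this, Real.rpow_one]
  have hlamr : lam ^ r = X ^ ((r : ℝ) / m) := by
    rw [hlam, ← Real.rpow_natCast, ← Real.rpow_mul hXpos.le]
    congr 1; ring
  have key := weighted_bound G K hK ℓ B hB C hdiff hpos hderiv
    (fun v => lam ^ (R.inf' hR (G.dist v))) (fun v => by positivity) X hXpos.le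
    (by
      intro u v h1 h2
      rw [← hlamm, ← pow_add]
      apply pow_le_pow_right₀ hlam1
      obtain ⟨y, hy, hy'⟩ := Finset.exists_mem_eq_inf' hR (G.dist u)
      have h3 : R.inf' hR (G.dist v) ≤ G.dist v y := Finset.inf'_le _ hy
      have h4 := ((SimpleGraph.Reachable.of_dist_ne_zero h1.ne').symm).dist_triangle_left y
      rw [G.dist_comm (u := v) (v := u)] at h4
      omega) t ht
  have hleft : lam ^ r * C x t ≤ ∑ v, lam ^ (R.inf' hR (G.dist v)) * C v t := by
    calc lam ^ r * C x t ≤ lam ^ (R.inf' hR (G.dist x)) * C x t := by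
          apply mul_le_mul_of_nonneg_right _ (hpos x t ht)
          apply pow_le_pow_right₀ hlam1
          exact Finset.le_inf' _ _ hrx
      _ ≤ _ := Finset.single_le_sum
          (f := fun v => lam ^ (R.inf' hR (G.dist v)) * C v t)
          (fun v _ => mul_nonneg (by positivity) (hpos v t ht)) (Finset.mem_univ x)
  have hright : ∑ v, lam ^ (R.inf' hR (G.dist v)) * C v 0 = ∑ y ∈ R, C y 0 := by
    rw [← Finset.sum_subset (Finset.subset_univ R)
      (fun v _ hv => by rw [hinit v hv, mul_zero])]
    refine Finset.sum_congr rfl fun y hy => ?_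
    have : R.inf' hR (G.dist y) ≤ G.dist y y := Finset.inf'_le _ hy
    rw [SimpleGraph.dist_self] at this
    rw [Nat.le_zero.1 this, pow_zero, one_mul]
  have hexp : Real.exp ((K : ℝ) ^ (2 * ℓ + 1) * B * (1 + X) * t) ≤ (4 : ℝ) ^ ((r : ℝ) / m) := by
    have e1 : (K : ℝ) ^ (2 * ℓ + 1) * B * (1 + X) * t = (1 + 1 / X) * ((r : ℝ) / m) := by
      have : (K : ℝ) ^ (2 * ℓ + 1) * B * (1 + X) * t = A * (1 + X) := by rw [hA]; ring
      rw [this, hX]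
      field_simp
      ring
    rw [e1, Real.exp_mul]
    apply Real.rpow_le_rpow (Real.exp_pos _).le _ (by positivity)
    have h1 : 1 + 1 / X ≤ 5 / 4 := by
      have : 1 / X ≤ 1 / 4 := one_div_le_one_div_of_le (by norm_num) hX4.le
      linarith
    have h2 : Real.exp (5 / 4) ^ 4 ≤ (4 : ℝ) ^ 4 := by
      rw [← Real.exp_nat_mul]
      have : ((4 : ℕ) : ℝ) * (5 / 4) = (5 : ℕ) * 1 := by norm_num
      rw [this, Real.exp_nat_mul]
      calc Real.exp 1 ^ 5 ≤ 3 ^ 5 := by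
            gcongr
            exact Real.exp_one_lt_three.le
        _ ≤ _ := by norm_num
    exact (Real.exp_le_exp.2 h1).trans (le_of_pow_le_pow_left₀ (by norm_num) (by norm_num) h2)
  have hfin : X ^ ((r : ℝ) / m) * C x t ≤ (4 : ℝ) ^ ((r : ℝ) / m) * ∑ y ∈ R, C y 0 := by
    rw [← hlamr]
    refine hleft.trans (key.trans ?_)
    rw [hright]
    exact mul_le_mul_of_nonneg_right hexp hS
  have hbase : 4 * m * (K : ℝ) ^ (2 * ℓ + 1) * B * t / r = 4 / X := by
    have : 4 * m * (K : ℝ) ^ (2 * ℓ + 1) * B * t = 4 * (m * A) := by rw [hA]; ring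
    rw [this, hX]
    field_simp
  rw [hbase, Real.div_rpow (by norm_num) hXpos.le, div_mul_eq_mul_div,
    le_div_iff₀ (Real.rpow_pos_of_pos hXpos _), mul_comm (C x t)]
  exact hfin
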